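/- Let (ψ, λ) solve the ODE problem −λ²[ρ̄|ξ|²ψ − (ρ̄ψ')'] = λμ(|ξ|⁴ψ − 2|ξ|²ψ'' + ψ'''') − g|ξ|²ρ̄'ψ on ℝ with ψ, ψ' → 0 at ±∞, ψ normalized so that ∫ρ̄(|ξ|²ψ² + |ψ'|²) dx = 1, and λ > 0. Then λ²(|ξ|) ≤ 2g|ξ|. In particular λ(|ξ|) → 0 as |ξ| → 0. -/

import Mathlib

open MeasureTheory Filter

/-- A differentiable function whose derivative is eventually at most `-ε < 0` tends to `-∞`. -/
lemma tendsto_atBot_of_eventually_hasDerivAt_le {f f' : ℝ → ℝ} {ε : ℝ} (hε : 0 < ε)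
    (hf : ∀ x, HasDerivAt f (f' x) x) (h : ∀ᶠ x in atTop, f' x ≤ -ε) :
    Tendsto f atTop atBot := by
  obtain ⟨a, ha⟩ := eventually_atTop.1 h
  have hlin : Tendsto (fun x => f a + (-ε) * (x - a)) atTop atBot :=
    tendsto_atBot_add_const_left _ _
      ((tendsto_atTop_add_const_right _ (-a) tendsto_id).const_mul_atTop_of_neg (by linarith))
  refine tendsto_atBot_mono' _ ?_ hlin
  filter_upwards [eventually_ge_atTop a] with x hx
  have := (convex_Ici a).image_sub_le_mul_sub_of_deriv_le (f := f) (C := -ε)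
    (fun y _ => (hf y).continuousAt.continuousWithinAt)
    (fun y _ => (hf y).differentiableAt.differentiableWithinAt)
    (fun y hy => by
      rw [(hf y).deriv]
      exact ha y (interior_subset hy))
    a Set.self_mem_Ici x hx hx
  linarith

/-- If `u, v → 0` at `+∞` and `u' = H + 2v`, then `H'` cannot stay below a negative constant. -/
lemma not_eventually_atTop_le_neg {u v H H' : ℝ → ℝ} {ε : ℝ} (hε : 0 < ε)
    (hu : ∀ x, HasDerivAt u (H x + 2 * v x) x) (hH : ∀ x, HasDerivAt H (H' x) x)
    (hu0 : Tendsto u atTop (nhds 0)) (hv0 : Tendsto v atTop (nhds 0)) :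
    ¬ ∀ᶠ x in atTop, H' x ≤ -ε := by
  intro h
  have hHbot := tendsto_atBot_of_eventually_hasDerivAt_le hε hH h
  have hsum : Tendsto (fun x => H x + 2 * v x) atTop atBot :=
    hHbot.atBot_add (hv0.const_mul 2)
  exact not_tendsto_nhds_of_tendsto_atBot
    (tendsto_atBot_of_eventually_hasDerivAt_le one_pos hu (hsum.eventually_le_atBot (-1))) 0 hu0

/-- If `u, v → 0` at `-∞` and `u' = H + 2v`, then `H'` cannot stay above a positive constant. -/
lemma not_eventually_atBot_ge {u v H H' : ℝ → ℝ} {ε : ℝ} (hε : 0 < ε)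
    (hu : ∀ x, HasDerivAt u (H x + 2 * v x) x) (hH : ∀ x, HasDerivAt H (H' x) x)
    (hu0 : Tendsto u atBot (nhds 0)) (hv0 : Tendsto v atBot (nhds 0)) :
    ¬ ∀ᶠ x in atBot, ε ≤ H' x := by
  intro h
  refine not_eventually_atTop_le_neg (u := fun x => -u (-x)) (v := fun x => v (-x))
    (H := fun x => H (-x)) (H' := fun x => -H' (-x)) hε (fun x => ?_) (fun x => ?_) ?_
    (hv0.comp tendsto_neg_atTop_atBot) ?_
  · exact (((hu (-x)).comp x (hasDerivAt_neg x)).neg).congr_deriv (by ring)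
  · exact ((hH (-x)).comp x (hasDerivAt_neg x)).congr_deriv (by ring)
  · simpa using (hu0.comp tendsto_neg_atTop_atBot).neg
  · filter_upwards [tendsto_neg_atTop_atBot.eventually h] with x hx
    linarith

/-- A `C¹` function whose derivative has compact support is bounded. -/
lemma exists_abs_le_of_hasCompactSupport_deriv {f : ℝ → ℝ} (hf : ContDiff ℝ 1 f)
    (hf' : HasCompactSupport (deriv f)) : ∃ C, ∀ x, |f x| ≤ C := by
  have hcont : Continuous (deriv f) := hf.continuous_deriv le_rfl
  have hint : Integrable (deriv f) := hcont.integrable_of_hasCompactSupport hf'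
  refine ⟨|f 0| + ∫ x, ‖deriv f x‖, fun x => ?_⟩
  have h1 : ∫ y in (0 : ℝ)..x, deriv f y = f x - f 0 :=
    intervalIntegral.integral_deriv_eq_sub
      (fun y _ => (hf.differentiable one_ne_zero) y) (hcont.intervalIntegrable _ _)
  have h2 : ‖∫ y in (0 : ℝ)..x, deriv f y‖ ≤ ∫ y, ‖deriv f y‖ :=
    intervalIntegral.norm_integral_le_integral_norm_uIoc.trans
      (setIntegral_le_integral hint.norm (Eventually.of_forall fun y => norm_nonneg _))
  rw [h1, Real.norm_eq_abs] at h2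
  have h3 := abs_add_le (f 0) (f x - f 0)
  rw [add_sub_cancel] at h3
  linarith

/-- If `(ψ, Λ)` with `Λ > 0` solves the fourth-order eigenvalue
ODE of the linearized Rayleigh–Taylor problem, with `ψ, ψ' → 0` at `±∞` and the
normalization `∫ ρ̄ (k²ψ² + ψ'²) = 1` (`k = |ξ| > 0`), then `Λ² ≤ 2 g k`.
(In particular the growth rate tends to `0` as `|ξ| → 0`.) -/
theorem stmt7_growth_rate_small_frequency
    (ρ : ℝ → ℝ) (hρ : ContDiff ℝ (⊤ : ℕ∞) ρ)
    (hρ' : HasCompactSupport (deriv ρ))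
    (hρpos : ∃ c > 0, ∀ x, c ≤ ρ x)
    (g μ k Λ : ℝ) (hg : 0 < g) (hμ : 0 < μ) (hk : 0 < k) (hΛ : 0 < Λ)
    (ψ : ℝ → ℝ) (hψsm : ContDiff ℝ 4 ψ)
    (hode : ∀ x : ℝ,
      -Λ ^ 2 * (ρ x * k ^ 2 * ψ x - deriv (fun y => ρ y * deriv ψ y) x)
        = Λ * μ * (k ^ 4 * ψ x - 2 * k ^ 2 * deriv^[2] ψ x + deriv^[4] ψ x)
          - g * k ^ 2 * deriv ρ x * ψ x)
    (hdecay : Tendsto ψ atTop (nhds 0) ∧ Tendsto ψ atBot (nhds 0) ∧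
      Tendsto (deriv ψ) atTop (nhds 0) ∧ Tendsto (deriv ψ) atBot (nhds 0))
    (hJInt : Integrable (fun x => ρ x * (k ^ 2 * (ψ x) ^ 2 + (deriv ψ x) ^ 2)))
    (hJ : (∫ x, ρ x * (k ^ 2 * (ψ x) ^ 2 + (deriv ψ x) ^ 2)) = 1) :
    Λ ^ 2 ≤ 2 * g * k := by
  obtain ⟨c, hc, hcρ⟩ := hρpos
  have hρ0 : ∀ x, 0 < ρ x := fun x => hc.trans_le (hcρ x)
  have hρ1 : ContDiff ℝ 1 ρ := hρ.of_le (by exact_mod_cast le_top)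
  obtain ⟨C, hC⟩ := exists_abs_le_of_hasCompactSupport_deriv hρ1 hρ'
  have dρ : ∀ x, HasDerivAt ρ (deriv ρ x) x := fun x =>
    ((hρ1.differentiable one_ne_zero) x).hasDerivAt
  have hdiff : ∀ n : ℕ, n + 1 ≤ 4 → ∀ x, HasDerivAt (deriv^[n] ψ) (deriv^[n + 1] ψ x) x := by
    intro n hn x
    have h : ContDiff ℝ 1 (deriv^[n] ψ) :=
      ContDiff.iterate_deriv' 1 n (hψsm.of_le (by rw [add_comm]; exact_mod_cast hn))
    rw [Function.iterate_succ_apply']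
    exact ((h.differentiable one_ne_zero) x).hasDerivAt
  have d0 : ∀ x, HasDerivAt ψ (deriv ψ x) x := hdiff 0 (by norm_num)
  have d1 : ∀ x, HasDerivAt (deriv ψ) (deriv^[2] ψ x) x := hdiff 1 (by norm_num)
  have d2 : ∀ x, HasDerivAt (deriv^[2] ψ) (deriv^[3] ψ x) x := hdiff 2 (by norm_num)
  have d3 : ∀ x, HasDerivAt (deriv^[3] ψ) (deriv^[4] ψ x) x := hdiff 3 (by norm_num)
  obtain ⟨t0, b0, t1, b1⟩ := hdecay
  by_contra! hlt
  have hgk : g * k < Λ ^ 2 := by nlinarith [mul_pos hg hk]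
  have hΛμ : 0 < Λ * μ := mul_pos hΛ hμ
  -- the boundary flux of the energy identity splits as `Λ μ H' + r`, where `r → 0` at `±∞`
  set u : ℝ → ℝ := fun x => ψ x * deriv ψ x
  set v : ℝ → ℝ := fun x => deriv ψ x ^ 2 with hv_def
  set H : ℝ → ℝ := fun x => ψ x * deriv^[2] ψ x - deriv ψ x ^ 2 with hH_def
  set H' : ℝ → ℝ := fun x => ψ x * deriv^[3] ψ x - deriv ψ x * deriv^[2] ψ x with hH'_def
  set r : ℝ → ℝ := fun x => -(2 * (Λ * μ) * k ^ 2) * (ψ x * deriv ψ x)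
    - Λ ^ 2 * (ρ x * (ψ x * deriv ψ x)) - g * k ^ 2 * (ρ x * ψ x ^ 2)
  set J : ℝ → ℝ := fun x => ρ x * (k ^ 2 * (ψ x) ^ 2 + (deriv ψ x) ^ 2) with hJ_def
  have hu : ∀ x, HasDerivAt u (H x + 2 * v x) x := fun x =>
    ((d0 x).mul (d1 x)).congr_deriv (by simp only [hH_def, hv_def]; ring)
  have hH : ∀ x, HasDerivAt H (H' x) x := fun x =>
    (((d0 x).mul (d2 x)).sub ((d1 x).pow 2)).congr_deriv (by
      simp only [hH'_def]; push_cast; ring)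
  have lim : ∀ l : Filter ℝ, Tendsto ψ l (nhds 0) → Tendsto (deriv ψ) l (nhds 0) →
      Tendsto u l (nhds 0) ∧ Tendsto v l (nhds 0) ∧ Tendsto r l (nhds 0) := by
    intro l h0 h1
    have hu0 : Tendsto u l (nhds 0) := by simpa using h0.mul h1
    have hv0 : Tendsto v l (nhds 0) := by simpa using h1.pow 2
    have hw0 : Tendsto (fun x => ψ x ^ 2) l (nhds 0) := by simpa using h0.pow 2
    have hbdd : ∀ {w : ℝ → ℝ}, Tendsto w l (nhds 0) →
        Tendsto (fun x => ρ x * w x) l (nhds 0) := fun hw =>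
      bdd_le_mul_tendsto_zero' C (Eventually.of_forall hC) hw
    refine ⟨hu0, hv0, ?_⟩
    simpa only [mul_zero, sub_zero] using ((hu0.const_mul (-(2 * (Λ * μ) * k ^ 2))).sub
      ((hbdd hu0).const_mul (Λ ^ 2))).sub ((hbdd hw0).const_mul (g * k ^ 2))
  obtain ⟨tu, tv, tr⟩ := lim atTop t0 t1
  obtain ⟨bu, bv, br⟩ := lim atBot b0 b1
  set G : ℝ → ℝ := fun x => Λ * μ * H' x + r x with hG_def
  set Q : ℝ → ℝ := fun x => -Λ ^ 2 * J x - Λ * μ * (k ^ 4 * ψ x ^ 2 + 2 * k ^ 2 * deriv ψ x ^ 2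
      + deriv^[2] ψ x ^ 2) - 2 * g * k ^ 2 * (ρ x * (ψ x * deriv ψ x)) with hQ_def
  have hG : ∀ x, HasDerivAt G (Q x) x := by
    intro x
    have e := hode x
    have hρψ : deriv (fun y => ρ y * deriv ψ y) x = deriv ρ x * deriv ψ x + ρ x * deriv^[2] ψ x :=
      ((dρ x).mul (d1 x)).deriv
    rw [hρψ] at e
    have hu1 := (d0 x).mul (d1 x)
    refine (((((d0 x).mul (d3 x)).sub ((d1 x).mul (d2 x))).const_mul (Λ * μ)).add
      (((hu1.const_mul (-(2 * (Λ * μ) * k ^ 2))).sub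
        (((dρ x).mul hu1).const_mul (Λ ^ 2))).sub
        (((dρ x).mul ((d0 x).pow 2)).const_mul (g * k ^ 2)))).congr_deriv ?_
    simp only [hQ_def, hJ_def, Pi.mul_apply, Pi.pow_apply]
    push_cast
    linear_combination (-ψ x) * e
  have hJ0 : ∀ x, 0 ≤ J x := fun x => mul_nonneg (hρ0 x).le (by positivity)
  have hQJ : ∀ x, Q x ≤ -(Λ ^ 2 - g * k) * J x := by
    intro x
    have h1 : 0 ≤ Λ * μ * (k ^ 4 * ψ x ^ 2 + 2 * k ^ 2 * deriv ψ x ^ 2 + deriv^[2] ψ x ^ 2) := by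
      positivity
    have h2 : 0 ≤ g * k * (ρ x * (k * ψ x + deriv ψ x) ^ 2) :=
      mul_nonneg (by positivity) (mul_nonneg (hρ0 x).le (sq_nonneg _))
    simp only [hQ_def, hJ_def]
    nlinarith
  have hanti : Antitone G := by
    refine antitone_of_deriv_nonpos (fun x => (hG x).differentiableAt) fun x => ?_
    rw [(hG x).deriv]
    nlinarith [hQJ x, mul_nonneg (sub_pos.2 hgk).le (hJ0 x)]
  have hG_nonneg : ∀ x, 0 ≤ G x := by
    intro x₀
    by_contra! hneg
    have hε : 0 < -G x₀ / 2 := by linarith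
    refine not_eventually_atTop_le_neg (div_pos hε hΛμ) hu hH tu tv ?_
    filter_upwards [eventually_ge_atTop x₀, tr.eventually (lt_mem_nhds (neg_lt_zero.2 hε))]
      with x hx hrx
    have := hanti hx
    rw [← neg_div, le_div_iff₀ hΛμ]
    simp only [hG_def] at this hrx ⊢
    linarith
  have hG_nonpos : ∀ x, G x ≤ 0 := by
    intro x₀
    by_contra! hpos
    have hε : 0 < G x₀ / 2 := by linarith
    refine not_eventually_atBot_ge (div_pos hε hΛμ) hu hH bu bv ?_
    filter_upwards [eventually_le_atBot x₀, br.eventually (gt_mem_nhds hε)] with x hx hrx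
    have := hanti hx
    rw [div_le_iff₀ hΛμ]
    simp only [hG_def] at this hrx ⊢
    linarith
  have hGz : G = fun _ => 0 := funext fun x => le_antisymm (hG_nonpos x) (hG_nonneg x)
  have hJz : ∀ x, J x ≤ 0 := by
    intro x
    have hQ0 : Q x = 0 := (hGz ▸ hG x).unique (hasDerivAt_const x (0 : ℝ))
    have := hQJ x
    rw [hQ0] at this
    by_contra! hJpos
    nlinarith [mul_pos (sub_pos.2 hgk) hJpos]
  have := integral_nonpos (μ := volume) hJz
  linarith
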